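/- Let α₁ > 0, α₂ > 0, R > 0, C > 0, and for Δ > 0 set a = (α₁+α₂)/(2R), d = a+Δ, χ = d² − 2α₂Δ/R, A = (a(d−√χ)/2 − α₂Δ/(2R))/(−√χ), and define I(t,Δ) = e^{−t/(2RC)} (1+2t/(d+√χ))^{(a−A)/(2RC)} (1+2t/(d−√χ))^{A/(2RC)} − 1/2. Let δ₀ be the unique positive solution of e^{−t/(2RC)}(1 + 2Rt/(α₁+α₂))^{(α₁+α₂)/(4R²C)} = 1/2. Then there exist Δ₀ > 0 and a function t : (0,Δ₀) → (0,∞) such that I(t(Δ),Δ) = 0 for all Δ ∈ (0,Δ₀), t(Δ) is the unique such solution in a fixed neighborhood of δ₀, and t(Δ) = δ₀ − (α₁/(α₁+α₂))·Δ + O(Δ² log(1/Δ)) as Δ → 0⁺. -/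

import Mathlib

open Set Real Filter Asymptotics

/-- elementary facts about the two roots `v < w`. -/
lemma roots_facts {a κ Δ w v : ℝ} (ha : 0 < a) (hκ : 0 < κ) (hκ1 : κ < 1) (hΔ : 0 < Δ)
    (hsum : w + v = a + Δ) (hprod : v * w = κ * a * Δ) (hvw : v < w) :
    0 < v ∧ v < Δ ∧ v < a ∧ a < w := by
  have hp : 0 < v * w := by rw [hprod]; positivity
  have hw : 0 < w := by nlinarith
  have hv : 0 < v := by
    by_contra h
    push Not at h
    nlinarith
  have haΔ : 0 < a * Δ := by positivity
  have h1 : (Δ - w) * (Δ - v) < 0 := by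
    have : (Δ - w) * (Δ - v) = Δ ^ 2 - (w + v) * Δ + v * w := by ring
    rw [this, hsum, hprod]; nlinarith
  have h2 : (a - w) * (a - v) < 0 := by
    have : (a - w) * (a - v) = a ^ 2 - (w + v) * a + v * w := by ring
    rw [this, hsum, hprod]; nlinarith
  refine ⟨hv, ?_, ?_, ?_⟩
  · by_contra h; push Not at h; nlinarith
  · by_contra h; push Not at h; nlinarith
  · by_contra h; push Not at h; nlinarith

noncomputable def GG (a Δ w v t : ℝ) : ℝ :=
  -t + (a - v * (Δ - v) / (w - v)) * Real.log (1 + t / w)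
    + (v * (Δ - v) / (w - v)) * Real.log (1 + t / v)

lemma GG_deriv {a Δ w v : ℝ} (hv : 0 < v) (hvw : v < w) (hsum : w + v = a + Δ)
    {t : ℝ} (ht : 0 < t) :
    HasDerivAt (GG a Δ w v) (-(t * (t + Δ)) / ((t + w) * (t + v))) t := by
  have hw : 0 < w := hv.trans hvw
  have hl : ∀ x : ℝ, 0 < x → HasDerivAt (fun t => Real.log (1 + t / x)) (1 / x / (1 + t / x)) t := by
    intro x hx
    have h1 : HasDerivAt (fun t : ℝ => 1 + t / x) (1 / x) t :=
      ((hasDerivAt_id t).div_const x).const_add 1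
    exact h1.log (by positivity)
  have := ((hasDerivAt_id t).neg.add ((hl w hw).const_mul (a - v * (Δ - v) / (w - v)))).add
    ((hl v hv).const_mul (v * (Δ - v) / (w - v)))
  refine (this.congr_deriv ?_)
  have hs : w - v ≠ 0 := by linarith
  have h3 : t + w ≠ 0 := by positivity
  have h4 : t + v ≠ 0 := by positivity
  have e1 : 1 / w / (1 + t / w) = 1 / (t + w) := by field_simp; ring
  have e2 : 1 / v / (1 + t / v) = 1 / (t + v) := by field_simp; ring
  rw [e1, e2]
  obtain rfl : a = w + v - Δ := by linarith
  field_simp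
  ring

/-- uniform lower bound on decrease -/
lemma GG_decr {a Δ w v δ : ℝ} (hv : 0 < v) (hvw : v < w) (hsum : w + v = a + Δ) (hvΔ : v < Δ)
    (hδ : 0 < δ) (ha : 0 < a) (hΔa : Δ ≤ a) {x y : ℝ} (hx : δ / 2 ≤ x) (hxy : x ≤ y) :
    GG a Δ w v y - GG a Δ w v x ≤ -(δ / (δ + 4 * a)) * (y - x) := by
  refine (convex_Icc x y).image_sub_le_mul_sub_of_deriv_le (f := GG a Δ w v) ?_ ?_ ?_ x
    ⟨le_rfl, hxy⟩ y ⟨hxy, le_rfl⟩ hxy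
  · intro t ht
    exact (GG_deriv hv hvw hsum (by linarith [ht.1])).continuousAt.continuousWithinAt
  · intro t ht
    rw [interior_Icc] at ht
    exact (GG_deriv hv hvw hsum (by linarith [ht.1])).differentiableAt.differentiableWithinAt
  · intro t ht
    rw [interior_Icc] at ht
    have ht0 : δ / 2 < t := by linarith [ht.1]
    have htp : 0 < t := by linarith
    have hw : 0 < w := hv.trans hvw
    rw [(GG_deriv hv hvw hsum htp).deriv, neg_div, neg_le_neg_iff,
      div_le_div_iff₀ (by positivity) (by positivity)]
    have h1 : δ * (t + w) ≤ t * (δ + 4 * a) := by nlinarith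
    have h2 : δ * (t + w) * (t + v) ≤ t * (δ + 4 * a) * (t + Δ) :=
      mul_le_mul h1 (by linarith) (by linarith) (by positivity)
    linarith

lemma GG_strictAnti {a Δ w v : ℝ} (hv : 0 < v) (hvw : v < w) (hsum : w + v = a + Δ)
    (hΔ : 0 < Δ) : StrictAntiOn (GG a Δ w v) (Ioi 0) := by
  refine strictAntiOn_of_deriv_neg (convex_Ioi 0) ?_ ?_
  · intro t ht
    exact (GG_deriv hv hvw hsum ht).continuousAt.continuousWithinAt
  · intro t ht
    rw [interior_Ioi] at ht
    have ht : 0 < t := ht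
    have hw : 0 < w := hv.trans hvw
    rw [(GG_deriv hv hvw hsum ht).deriv, neg_div]
    have : 0 < t * (t + Δ) / ((t + w) * (t + v)) := by positivity
    linarith

set_option maxHeartbeats 2000000 in
/-- the residual at the linear approximation -/
lemma GG_resid {a κ Δ w v δ : ℝ} (ha : 0 < a) (hκ : 0 < κ) (hκ1 : κ < 1) (hΔ : 0 < Δ)
    (hsum : w + v = a + Δ) (hprod : v * w = κ * a * Δ) (hvw : v < w) (hδ : 0 < δ)
    (hΔa : Δ ≤ a / 4) (hΔδ : Δ ≤ δ / 4) (hΔe : 1 ≤ Real.log (1 / Δ))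
    (hΔκ : Δ ^ 2 + 2 * δ / κ * Δ ≤ 1) :
    |GG a Δ w v (δ - (1 - κ) * Δ) - (-δ + a * Real.log (1 + δ / a))|
      ≤ 6 / a * (Δ ^ 2 * Real.log (1 / Δ)) := by
  obtain ⟨hv, hvΔ, hva, haw⟩ := roots_facts ha hκ hκ1 hΔ hsum hprod hvw
  have hw : 0 < w := ha.trans haw
  set T := δ - (1 - κ) * Δ with hT
  have hT0 : 0 < T := by nlinarith
  have hTδ : T ≤ δ := by nlinarith
  set A := v * (Δ - v) / (w - v) with hA
  have hs : a / 2 ≤ w - v := by linarith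
  have hvv : v * (Δ - v) ≤ Δ ^ 2 := by nlinarith
  have hvv0 : 0 ≤ v * (Δ - v) := mul_nonneg hv.le (by linarith)
  have hA0 : 0 ≤ A := div_nonneg hvv0 (by linarith)
  have hA1 : A ≤ 2 * Δ ^ 2 / a := by
    rw [hA, div_le_div_iff₀ (by linarith) ha]
    nlinarith [sq_nonneg Δ]
  -- r
  have hr : w - a - (1 - κ) * Δ = v * (Δ - v) / a := by
    rw [eq_div_iff ha.ne']
    have : w = a + Δ - v := by linarith
    subst this
    nlinarith
  have hr0 : 0 ≤ v * (Δ - v) / a := by positivity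
  have hr1 : v * (Δ - v) / a ≤ Δ ^ 2 / a := by gcongr
  set r := v * (Δ - v) / a with hrdef
  -- main part
  have e1 : Real.log (1 + T / w) = Real.log (w + T) - Real.log w := by
    rw [← Real.log_div (by positivity) hw.ne']; congr 1; field_simp
  have e2 : Real.log (1 + δ / a) = Real.log (a + δ) - Real.log a := by
    rw [← Real.log_div (by positivity) ha.ne']; congr 1; field_simp
  have hwT : w + T = a + δ + r := by rw [hT]; linarith
  have l1 : 0 ≤ Real.log (w + T) - Real.log (a + δ) := by
    have := Real.log_le_log (x := a + δ) (y := w + T) (by positivity) (by linarith)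
    linarith
  have l2 : a * (Real.log (w + T) - Real.log (a + δ)) ≤ r := by
    rw [← Real.log_div (by positivity) (by positivity)]
    have h := Real.log_le_sub_one_of_pos (x := (w + T) / (a + δ)) (by positivity)
    have h' : (w + T) / (a + δ) - 1 = r / (a + δ) := by rw [hwT]; field_simp; ring
    rw [h'] at h
    have h3 : r / (a + δ) ≤ r / a := by gcongr; linarith
    calc a * _ ≤ a * (r / a) := by gcongr; linarith
      _ = r := by field_simp
  have l3 : a * (Real.log w - Real.log a) ≤ (1 - κ) * Δ + r := by
    rw [← Real.log_div hw.ne' ha.ne']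
    have h := Real.log_le_sub_one_of_pos (x := w / a) (by positivity)
    calc a * _ ≤ a * (w / a - 1) := by gcongr
      _ = w - a := by field_simp
      _ = _ := by linarith
  have l4 : (1 - κ) * Δ + r - Δ ^ 2 / a ≤ a * (Real.log w - Real.log a) := by
    rw [← Real.log_div hw.ne' ha.ne']
    have h := Real.one_sub_inv_le_log_of_pos (x := w / a) (by positivity)
    calc (1 - κ) * Δ + r - Δ ^ 2 / a = (w - a) - Δ ^ 2 / a := by linarith
      _ ≤ a * (1 - (w / a)⁻¹) := by
        have h5 : a * (1 - (w / a)⁻¹) = (w - a) - (w - a) ^ 2 / w := by field_simp; ring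
        rw [h5]
        have : (w - a) ^ 2 / w ≤ Δ ^ 2 / a := by
          apply div_le_div₀ (by positivity) _ ha haw.le
          apply pow_le_pow_left₀ <;> linarith
        linarith
      _ ≤ _ := by gcongr
  -- log part
  have m0 : 0 ≤ Real.log (1 + T / w) := Real.log_nonneg (by
    have : 0 < T / w := by positivity
    linarith)
  have m1 : Real.log (1 + T / w) ≤ Real.log (1 + T / v) := by
    apply Real.log_le_log (by positivity)
    gcongr
  have m2 : Real.log (1 + T / v) ≤ 2 * Real.log (1 / Δ) := by
    have : 2 * Real.log (1 / Δ) = Real.log ((1 / Δ) ^ 2) := by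
      rw [Real.log_pow]; norm_num
    rw [this]
    apply Real.log_le_log (by positivity)
    have hvl : κ * Δ / 2 ≤ v := by
      have hw2 : w ≤ 2 * a := by linarith
      have : κ * a * Δ ≤ v * (2 * a) := by rw [← hprod]; gcongr
      have h7 : a * (κ * Δ) ≤ a * (v * 2) := by linarith
      have := le_of_mul_le_mul_left h7 ha
      linarith
    have h8 : T / v ≤ δ / (κ * Δ / 2) := by gcongr
    have h9 : 1 + δ / (κ * Δ / 2) ≤ (1 / Δ) ^ 2 := by
      rw [one_div, inv_pow, ← one_div, le_div_iff₀ (by positivity)]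
      calc _ = Δ ^ 2 + 2 * δ / κ * Δ := by field_simp
        _ ≤ 1 := hΔκ
    linarith
  set L := Real.log (1 / Δ)
  have n1 : 0 ≤ A * (Real.log (1 + T / v) - Real.log (1 + T / w)) :=
    mul_nonneg hA0 (by linarith)
  have n2 : A * (Real.log (1 + T / v) - Real.log (1 + T / w)) ≤ 2 * Δ ^ 2 / a * (2 * L) :=
    mul_le_mul hA1 (by linarith) (by linarith) (by positivity)
  have key : GG a Δ w v T - (-δ + a * Real.log (1 + δ / a)) =
      (1 - κ) * Δ + a * (Real.log (w + T) - Real.log (a + δ)) - a * (Real.log w - Real.log a)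
      + A * (Real.log (1 + T / v) - Real.log (1 + T / w)) := by
    rw [e2]
    unfold GG
    rw [← hA]
    have : -T = -δ + (1 - κ) * Δ := by rw [hT]; ring
    rw [this]
    linear_combination a * e1
  have q : 0 ≤ Δ ^ 2 / a := by positivity
  have q2 : Δ ^ 2 / a ≤ Δ ^ 2 / a * L := by nlinarith
  have q3 : 2 * Δ ^ 2 / a * (2 * L) = 4 * (Δ ^ 2 / a * L) := by ring
  have q4 : 6 / a * (Δ ^ 2 * L) = 6 * (Δ ^ 2 / a * L) := by ring
  have q5 : 0 ≤ a * (Real.log (w + T) - Real.log (a + δ)) := by positivity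
  rw [key, q4, abs_le]
  constructor <;> linarith

/-- existence near the linear approximation -/
lemma GG_root {a κ Δ w v δ : ℝ} (ha : 0 < a) (hκ : 0 < κ) (hκ1 : κ < 1) (hΔ : 0 < Δ)
    (hsum : w + v = a + Δ) (hprod : v * w = κ * a * Δ) (hvw : v < w) (hδ : 0 < δ)
    (hΔa : Δ ≤ a / 4) (hΔδ : Δ ≤ δ / 4) (hΔe : 1 ≤ Real.log (1 / Δ))
    (hΔκ : Δ ^ 2 + 2 * δ / κ * Δ ≤ 1)
    (hΔm : 6 / a / (δ / (δ + 4 * a)) * Δ ≤ δ / 8) :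
    ∃ t, GG a Δ w v t = -δ + a * Real.log (1 + δ / a) ∧ t ∈ Ioo (δ - δ / 2) (δ + δ / 2) ∧
      |t - (δ - (1 - κ) * Δ)| ≤ 6 / a / (δ / (δ + 4 * a)) * (Δ ^ 2 * Real.log (1 / Δ)) := by
  obtain ⟨hv, hvΔ, hva, haw⟩ := roots_facts ha hκ hκ1 hΔ hsum hprod hvw
  have hres := GG_resid ha hκ hκ1 hΔ hsum hprod hvw hδ hΔa hΔδ hΔe hΔκ
  set T := δ - (1 - κ) * Δ with hT
  set m := δ / (δ + 4 * a) with hm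
  have hm0 : 0 < m := by positivity
  set E := Δ ^ 2 * Real.log (1 / Δ) with hE
  have hE0 : 0 ≤ E := by positivity
  have hEΔ : E ≤ Δ := by
    have h := Real.log_le_sub_one_of_pos (x := 1 / Δ) (by positivity)
    have : E ≤ Δ ^ 2 * (1 / Δ) := by rw [hE]; gcongr; linarith
    calc E ≤ _ := this
      _ = Δ := by field_simp
  set e := 6 / a / m * E with he
  have he0 : 0 ≤ e := by positivity
  have heδ : e ≤ δ / 8 := by
    have : e ≤ 6 / a / m * Δ := by rw [he]; gcongr
    linarith
  have hem : m * e = 6 / a * E := by rw [he]; field_simp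
  have hT1 : T ≤ δ := by nlinarith
  have hT2 : δ - δ / 4 ≤ T := by nlinarith
  have hlow := GG_decr (x := T - e) (y := T) hv hvw hsum hvΔ hδ ha (by linarith) (by linarith)
    (by linarith)
  have hup := GG_decr (x := T) (y := T + e) hv hvw hsum hvΔ hδ ha (by linarith) (by linarith)
    (by linarith)
  rw [← hm] at hlow hup
  rw [abs_le] at hres
  have hcont : ContinuousOn (GG a Δ w v) (Icc (T - e) (T + e)) := by
    intro t ht
    exact (GG_deriv hv hvw hsum (by linarith [ht.1])).continuousAt.continuousWithinAt
  obtain ⟨t, ht, hteq⟩ := intermediate_value_Icc' (by linarith : T - e ≤ T + e) hcont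
    (show -δ + a * Real.log (1 + δ / a) ∈ Icc _ _ from ⟨by nlinarith, by nlinarith⟩)
  refine ⟨t, hteq, ⟨by linarith [ht.1], by linarith [ht.2]⟩, ?_⟩
  rw [abs_le]
  constructor <;> linarith [ht.1, ht.2]

/-- Theorem 6.10 (bootstrapping): the threshold-crossing equation `I(t,Δ) = 0` of the
advanced NOR gate model for falling input transitions has, for all sufficiently small
`Δ > 0`, a solution `t(Δ)` that is unique in a fixed neighborhood of `δ₀` (the delay at
`Δ = 0`), and `t(Δ) = δ₀ - (α₁/(α₁+α₂))Δ + O(Δ² log(1/Δ))` as `Δ → 0⁺`. -/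
theorem stmt16 (α₁ α₂ R C δ₀ : ℝ)
    (hα₁ : 0 < α₁) (hα₂ : 0 < α₂) (hR : 0 < R) (hC : 0 < C)
    (hδ₀pos : 0 < δ₀)
    (hδ₀eq : Real.exp (-δ₀/(2*R*C)) *
      (1 + 2*R*δ₀/(α₁+α₂)) ^ ((α₁+α₂)/(4*R^2*C)) = 1/2)
    (hδ₀uniq : ∀ t > 0,
      Real.exp (-t/(2*R*C)) * (1 + 2*R*t/(α₁+α₂)) ^ ((α₁+α₂)/(4*R^2*C)) = 1/2 → t = δ₀) :
    let I : ℝ → ℝ → ℝ := fun t Δ =>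
      let a := (α₁ + α₂)/(2*R)
      let d := a + Δ
      let χ := d^2 - 2*α₂*Δ/R
      let A := (a*(d - Real.sqrt χ)/2 - α₂*Δ/(2*R))/(-Real.sqrt χ)
      Real.exp (-t/(2*R*C)) * (1 + 2*t/(d + Real.sqrt χ)) ^ ((a - A)/(2*R*C)) *
        (1 + 2*t/(d - Real.sqrt χ)) ^ (A/(2*R*C)) - 1/2
    ∃ Δ₀ > 0, ∃ η > 0, ∃ tf : ℝ → ℝ,
      (∀ Δ ∈ Ioo (0:ℝ) Δ₀, 0 < tf Δ ∧ I (tf Δ) Δ = 0 ∧ tf Δ ∈ Ioo (δ₀ - η) (δ₀ + η) ∧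
        ∀ t' ∈ Ioo (δ₀ - η) (δ₀ + η), I t' Δ = 0 → t' = tf Δ) ∧
      (fun Δ => tf Δ - (δ₀ - (α₁/(α₁+α₂))*Δ)) =O[nhdsWithin 0 (Ioi 0)]
        (fun Δ => Δ^2 * Real.log (1/Δ)) := by
  intro I
  set a := (α₁ + α₂)/(2*R) with ha_def
  set κ := α₂/(α₁+α₂) with hκ_def
  have ha : 0 < a := by positivity
  have hκ : 0 < κ := by positivity
  have hκ1 : κ < 1 := by rw [hκ_def, div_lt_one (by positivity)]; linarith
  have hc : α₁/(α₁+α₂) = 1 - κ := by rw [hκ_def]; field_simp; ring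
  have hβ : α₂ / R = 2 * κ * a := by rw [hκ_def, ha_def]; field_simp
  have hL : 1/2 = Real.exp ((-δ₀ + a * Real.log (1 + δ₀ / a)) / (2*R*C)) := by
    rw [← hδ₀eq, Real.rpow_def_of_pos (by positivity), ← Real.exp_add]
    congr 1
    have : 2*R*δ₀/(α₁+α₂) = δ₀ / a := by rw [ha_def]; field_simp
    rw [this, ha_def]
    field_simp
    ring
  -- roots
  have hroots : ∀ Δ > 0, ∃ w v : ℝ, w + v = a + Δ ∧ v * w = κ * a * Δ ∧ v < w ∧
      ∀ t > 0, (I t Δ = 0 ↔ GG a Δ w v t = -δ₀ + a * Real.log (1 + δ₀ / a)) := by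
    intro Δ hΔ
    have hχ : 0 < (a + Δ)^2 - 2*α₂*Δ/R := by
      have : 2*α₂*Δ/R = 2 * Δ * (2 * κ * a) := by rw [← hβ]; ring
      rw [this]
      have : 0 < a * Δ * (1 - κ) := by have := sub_pos.2 hκ1; positivity
      nlinarith [sq_nonneg (a - Δ)]
    set s := Real.sqrt ((a + Δ)^2 - 2*α₂*Δ/R) with hs_def
    have hs : 0 < s := Real.sqrt_pos.2 hχ
    have hs2 : s ^ 2 = (a + Δ)^2 - 4 * κ * a * Δ := by
      rw [hs_def, Real.sq_sqrt hχ.le]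
      have : 2*α₂*Δ/R = 2 * Δ * (2 * κ * a) := by rw [← hβ]; ring
      rw [this]; ring
    have hprod : (a + Δ - s) / 2 * ((a + Δ + s) / 2) = κ * a * Δ := by nlinarith
    have hsum : (a + Δ + s) / 2 + (a + Δ - s) / 2 = a + Δ := by ring
    have hvw : (a + Δ - s) / 2 < (a + Δ + s) / 2 := by linarith
    refine ⟨(a + Δ + s) / 2, (a + Δ - s) / 2, hsum, hprod, hvw, ?_⟩
    intro t ht
    obtain ⟨hv, hvΔ, hva, haw⟩ := roots_facts ha hκ hκ1 hΔ hsum hprod hvw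
    have hdv : 0 < a + Δ - s := by linarith
    have hdw : 0 < a + Δ + s := by linarith
    have hI : I t Δ = Real.exp (GG a Δ ((a + Δ + s) / 2) ((a + Δ - s) / 2) t / (2*R*C)) - 1/2 := by
      simp only [I]
      rw [← hs_def]
      have hA : (a*(a + Δ - s)/2 - α₂*Δ/(2*R))/(-s) =
          (a + Δ - s) / 2 * (Δ - (a + Δ - s) / 2) / ((a + Δ + s) / 2 - (a + Δ - s) / 2) := by
        have h1 : (a + Δ + s) / 2 - (a + Δ - s) / 2 = s := by ring
        have h2 : α₂*Δ/(2*R) = κ * a * Δ := by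
          have : α₂*Δ/(2*R) = α₂ / R * Δ / 2 := by field_simp
          rw [this, hβ]; ring
        rw [h1, h2, div_neg, ← neg_div, ← hprod]
        congr 1
        ring
      have h3 : 1 + 2*t/(a + Δ + s) = 1 + t / ((a + Δ + s) / 2) := by field_simp
      have h4 : 1 + 2*t/(a + Δ - s) = 1 + t / ((a + Δ - s) / 2) := by field_simp
      rw [hA, h3, h4, Real.rpow_def_of_pos (by positivity), Real.rpow_def_of_pos (by positivity),
        ← Real.exp_add, ← Real.exp_add]
      congr 2
      unfold GG
      ring
    rw [hI, sub_eq_zero, hL, Real.exp_eq_exp, div_left_inj' (by positivity)]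
  set K := 6 / a / (δ₀ / (δ₀ + 4 * a)) with hK
  have hK0 : 0 < K := by positivity
  set Δ₀ := min (min (a / 4) (δ₀ / 4)) (min (Real.exp (-1)) (min (1 / (1 + 2 * δ₀ / κ)) (δ₀ / 8 / K)))
    with hΔ₀
  have hmain : ∀ Δ ∈ Ioo (0:ℝ) Δ₀, ∃ t, 0 < t ∧ I t Δ = 0 ∧
      t ∈ Ioo (δ₀ - δ₀ / 2) (δ₀ + δ₀ / 2) ∧
      (∀ t' ∈ Ioo (δ₀ - δ₀ / 2) (δ₀ + δ₀ / 2), I t' Δ = 0 → t' = t) ∧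
      |t - (δ₀ - (1 - κ) * Δ)| ≤ K * (Δ ^ 2 * Real.log (1 / Δ)) := by
    rintro Δ ⟨hΔ, hlt⟩
    simp only [hΔ₀, lt_min_iff] at hlt
    obtain ⟨⟨h1, h2⟩, h3, h4, h5⟩ := hlt
    obtain ⟨w, v, hsum, hprod, hvw, hiff⟩ := hroots Δ hΔ
    obtain ⟨hv, hvΔ, hva, haw⟩ := roots_facts ha hκ hκ1 hΔ hsum hprod hvw
    have h3' : 1 ≤ Real.log (1 / Δ) := by
      have := Real.log_lt_log hΔ h3
      rw [Real.log_exp] at this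
      rw [one_div, Real.log_inv]
      linarith
    have h4' : Δ ^ 2 + 2 * δ₀ / κ * Δ ≤ 1 := by
      have hΔ1 : Δ < 1 := h3.trans (by rw [Real.exp_lt_one_iff]; norm_num)
      rw [lt_div_iff₀ (by positivity)] at h4
      nlinarith
    have h5' : K * Δ ≤ δ₀ / 8 := by
      rw [lt_div_iff₀ hK0] at h5
      linarith
    obtain ⟨t, hteq, htm, htb⟩ := GG_root ha hκ hκ1 hΔ hsum hprod hvw hδ₀pos h1.le h2.le h3' h4' h5'
    have ht0 : 0 < t := by linarith [htm.1]
    refine ⟨t, ht0, (hiff t ht0).2 hteq, htm, ?_, htb⟩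
    intro t' ht' hI'
    have ht0' : 0 < t' := by linarith [ht'.1]
    exact (GG_strictAnti hv hvw hsum hΔ).injOn ht0' ht0 (((hiff t' ht0').1 hI').trans hteq.symm)
  have hΔ₀pos : 0 < Δ₀ := by
    simp only [hΔ₀, lt_min_iff]
    refine ⟨⟨?_, ?_⟩, ?_, ?_, ?_⟩ <;> positivity
  choose! tf htf using hmain
  refine ⟨Δ₀, hΔ₀pos, δ₀ / 2, by positivity, tf, ?_, ?_⟩
  · intro Δ hΔ
    obtain ⟨h1, h2, h3, h4, -⟩ := htf Δ hΔ
    exact ⟨h1, h2, h3, h4⟩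
  · refine IsBigO.of_bound K ?_
    filter_upwards [Ioo_mem_nhdsGT hΔ₀pos] with Δ hΔ
    have := (htf Δ hΔ).2.2.2.2
    rw [hc, Real.norm_eq_abs, Real.norm_eq_abs]
    exact this.trans (mul_le_mul_of_nonneg_left (le_abs_self _) hK0.le)
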